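/- arXiv:2503.23759 — 2 statements merged into one kernel-verified Lean document; each statement's English description precedes it below -/
import Mathlib

section
/- Let a and b be strings over Σ and let v = a·b be their concatenation. For all integers i, j with 0 ≤ i, j ≤ m, i ≤ |a|, j ≤ |b|, and i + j < |v|, it holds that M_v[i,j] = true if and only if there exist integers k, ℓ with 0 ≤ k, ℓ ≤ m such that M_a[i,k] = true, T_{a,b}[k,ℓ] = true, and M_b[ℓ,j] = true. -/
/-- `s` belongs to the Kleene star of the dictionary `D`:
`s` is a concatenation of finitely many (possibly zero) words of `D`. -/
def InStar {σ : Type*} (D : Finset (List σ)) (s : List σ) : Prop :=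
  ∃ fs : List (List σ), (∀ f ∈ fs, f ∈ D) ∧ fs.flatten = s

/-- `M_x[i,j]`: `i + j ≤ |x|` and the string `x` with its first `i` and
last `j` characters removed belongs to `D*`. -/
def Mmat {σ : Type*} (D : Finset (List σ)) (x : List σ) (i j : ℕ) : Prop :=
  i + j ≤ x.length ∧ InStar D ((x.drop i).rdrop j)

/-- `T_{a,b}[k,ℓ]`: `k ≤ |a|`, `ℓ ≤ |b|`, and the concatenation of the last `k`
characters of `a` with the first `ℓ` characters of `b` is a word of `D`. -/
def Tmat {σ : Type*} (D : Finset (List σ)) (a b : List σ) (k ℓ : ℕ) : Prop :=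
  k ≤ a.length ∧ ℓ ≤ b.length ∧ (a.rtake k ++ b.take ℓ) ∈ D

theorem InStar.nil {σ : Type*} (D : Finset (List σ)) : InStar D [] :=
  ⟨[], by simp, rfl⟩

theorem InStar.of_mem {σ : Type*} {D : Finset (List σ)} {s : List σ} (hs : s ∈ D) :
    InStar D s :=
  ⟨[s], by simpa using hs, by simp⟩

theorem InStar.append {σ : Type*} {D : Finset (List σ)} {s t : List σ}
    (hs : InStar D s) (ht : InStar D t) : InStar D (s ++ t) := by
  obtain ⟨fs, hfs, rfl⟩ := hs
  obtain ⟨gs, hgs, rfl⟩ := ht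
  refine ⟨fs ++ gs, fun f hf => ?_, List.flatten_append⟩
  exact (List.mem_append.mp hf).elim (hfs f) (hgs f)

/-- In a nonempty factorized string `u ++ w`, some factor `q ++ r` meets or crosses the
boundary between `u` and `w`. -/
theorem InStar.exists_boundary_factor {σ : Type*} {D : Finset (List σ)} {u w : List σ}
    (h : InStar D (u ++ w)) (hne : u ++ w ≠ []) :
    ∃ p q r s, u = p ++ q ∧ w = r ++ s ∧ InStar D p ∧ q ++ r ∈ D ∧ InStar D s := by
  obtain ⟨fs, hfs, heq⟩ := h
  induction fs generalizing u with
  | nil => exact absurd heq.symm hne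
  | cons f gs ih =>
    have hf : f ∈ D := hfs f List.mem_cons_self
    have hgs : ∀ g ∈ gs, g ∈ D := fun g hg => hfs g (List.mem_cons_of_mem f hg)
    rw [List.flatten_cons, List.append_eq_append_iff] at heq
    rcases heq with ⟨u', rfl, hrest⟩ | ⟨r, rfl, rfl⟩
    · rcases eq_or_ne u' [] with rfl | hu'
      · exact ⟨[], f, [], w, by simp, rfl, InStar.nil D, by simpa using hf,
          gs, hgs, by simpa using hrest⟩
      · obtain ⟨p, q, r, s, rfl, rfl, hp, hqr, hs⟩ := ih (by simp [hu']) hgs hrest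
        exact ⟨f ++ p, q, r, s, by simp, rfl, (InStar.of_mem hf).append hp, hqr, hs⟩
    · exact ⟨[], u, r, gs.flatten, rfl, rfl, InStar.nil D, hf, gs, hgs, rfl⟩

theorem List.rtake_append_of_length_eq {σ : Type*} (x y : List σ) {n : ℕ}
    (hn : n = y.length) : (x ++ y).rtake n = y := by
  subst hn; simp [List.rtake]

theorem List.drop_rdrop_append {σ : Type*} (x y z : List σ) :
    ((x ++ (y ++ z)).drop x.length).rdrop z.length = y := by
  simp [List.rdrop]

theorem mmat_iff_exists {σ : Type*} (D : Finset (List σ)) (x : List σ) (i j : ℕ) :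
    Mmat D x i j ↔
      ∃ p y s, x = p ++ (y ++ s) ∧ p.length = i ∧ s.length = j ∧ InStar D y := by
  constructor
  · rintro ⟨hle, hy⟩
    refine ⟨x.take i, _, (x.drop i).rtake j, ?_, ?_, ?_, hy⟩
    · simp [List.rdrop, List.rtake]
    · simp; omega
    · simp [List.rtake]; omega
  · rintro ⟨p, y, s, rfl, rfl, rfl, hy⟩
    refine ⟨by simp, ?_⟩
    rwa [List.drop_rdrop_append]

theorem stmt0 {σ : Type*} [Fintype σ] (D : Finset (List σ)) (hD : D.Nonempty)
    (hne : ∀ d ∈ D, d ≠ []) (m : ℕ) (hm : m = D.sup List.length)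
    (a b : List σ) (i j : ℕ) (hi : i ≤ m) (hj : j ≤ m)
    (hia : i ≤ a.length) (hjb : j ≤ b.length) (hij : i + j < (a ++ b).length) :
    Mmat D (a ++ b) i j ↔
      ∃ k ℓ : ℕ, k ≤ m ∧ ℓ ≤ m ∧ Mmat D a i k ∧ Tmat D a b k ℓ ∧ Mmat D b ℓ j := by
  constructor
  · intro h
    obtain ⟨a₁, u, rfl, rfl⟩ : ∃ a₁ u, a = a₁ ++ u ∧ a₁.length = i :=
      ⟨a.take i, a.drop i, by simp, by simpa using hia⟩
    obtain ⟨w, b₂, rfl, rfl⟩ : ∃ w b₂, b = w ++ b₂ ∧ b₂.length = j :=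
      ⟨b.rdrop j, b.rtake j, by simp [List.rdrop, List.rtake], by simp [List.rtake]; omega⟩
    have hstar : InStar D (u ++ w) := by
      have := h.2
      rwa [show a₁ ++ u ++ (w ++ b₂) = a₁ ++ ((u ++ w) ++ b₂) by simp,
        List.drop_rdrop_append] at this
    have huw : u ++ w ≠ [] := by
      intro h0
      have := congrArg List.length h0
      simp only [List.length_append, List.length_nil] at this hij
      omega
    obtain ⟨p, q, r, s, rfl, rfl, hp, hqr, hs⟩ := hstar.exists_boundary_factor huw
    have hlen : (q ++ r).length ≤ m := hm ▸ Finset.le_sup (f := List.length) hqr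
    rw [List.length_append] at hlen
    refine ⟨q.length, r.length, by omega, by omega,
      (mmat_iff_exists ..).mpr ⟨a₁, p, q, rfl, rfl, rfl, hp⟩,
      ⟨by simp; omega, by simp, ?_⟩,
      (mmat_iff_exists ..).mpr ⟨r, s, b₂, by simp, rfl, rfl, hs⟩⟩
    rw [← List.append_assoc, List.rtake_append_of_length_eq _ _ rfl, List.append_assoc,
      List.take_left]
    exact hqr
  · rintro ⟨k, ℓ, -, -, hMa, hT, hMb⟩
    obtain ⟨a₁, p, q, rfl, rfl, rfl, hp⟩ := (mmat_iff_exists ..).mp hMa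
    obtain ⟨r, s, b₂, rfl, rfl, rfl, hs⟩ := (mmat_iff_exists ..).mp hMb
    have hqr := hT.2.2
    rw [← List.append_assoc, List.rtake_append_of_length_eq _ _ rfl, List.take_left] at hqr
    exact (mmat_iff_exists ..).mpr ⟨a₁, p ++ ((q ++ r) ++ s), b₂, by simp, rfl, rfl,
      hp.append ((InStar.of_mem hqr).append hs)⟩
end

section
/- Let a and b be strings over Σ. For all integers i, j with 0 ≤ i, j ≤ m, if there exist integers k, ℓ with 0 ≤ k, ℓ ≤ m such that M_a[i,k] = true, T_{a,b}[k,ℓ] = true, and M_b[ℓ,j] = true, then M_{a·b}[i,j] = true. -/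
theorem List.rdrop_append_rtake {σ : Type*} (x : List σ) (k : ℕ) :
    x.rdrop k ++ x.rtake k = x :=
  List.take_append_drop _ _

theorem List.rtake_drop_of_add_le {σ : Type*} {x : List σ} {i k : ℕ} (h : i + k ≤ x.length) :
    (x.drop i).rtake k = x.rtake k := by
  simp only [List.rtake, List.drop_drop, List.length_drop]
  congr 1
  omega

theorem List.rdrop_append_of_le_length_right {σ : Type*} (x : List σ) {y : List σ} {j : ℕ}
    (h : j ≤ y.length) : (x ++ y).rdrop j = x ++ y.rdrop j := by
  simp only [List.rdrop, List.length_append]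
  rw [Nat.add_sub_assoc h, List.take_length_add_append]

/-- Removing `i` leading and `j` trailing characters from `a ++ b` leaves the trimmed parts of
`a` and `b` joined by the characters around the boundary. -/
theorem List.rdrop_drop_append {σ : Type*} {a b : List σ} {i j k l : ℕ}
    (ha : i + k ≤ a.length) (hb : l + j ≤ b.length) :
    ((a ++ b).drop i).rdrop j =
      (a.drop i).rdrop k ++ (a.rtake k ++ b.take l) ++ (b.drop l).rdrop j := by
  have hlen : j ≤ (b.drop l).length := by
    rw [List.length_drop]
    omega
  have hsplit : (a ++ b).drop i =
      (a.drop i).rdrop k ++ (a.rtake k ++ b.take l) ++ b.drop l := by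
    rw [List.drop_append_of_le_length (by omega), ← List.rtake_drop_of_add_le ha,
      ← List.append_assoc, List.rdrop_append_rtake, List.append_assoc, List.take_append_drop]
  rw [hsplit, List.rdrop_append_of_le_length_right _ hlen]

theorem stmt1 {σ : Type*} [Fintype σ] (D : Finset (List σ)) (hD : D.Nonempty)
    (hne : ∀ d ∈ D, d ≠ []) (m : ℕ) (hm : m = D.sup List.length)
    (a b : List σ) (i j : ℕ) (hi : i ≤ m) (hj : j ≤ m)
    (h : ∃ k ℓ : ℕ, k ≤ m ∧ ℓ ≤ m ∧ Mmat D a i k ∧ Tmat D a b k ℓ ∧ Mmat D b ℓ j) :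
    Mmat D (a ++ b) i j := by
  obtain ⟨k, l, -, -, ⟨ha, hsa⟩, ⟨-, -, hT⟩, hb, hsb⟩ := h
  refine ⟨by rw [List.length_append]; omega, ?_⟩
  rw [List.rdrop_drop_append ha hb]
  exact (hsa.append (InStar.of_mem hT)).append hsb
end
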